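/- Define, for positive reals t012, e01, e10, e12, e21, the polynomials ⊤_c = e01·e10²·e12²·e21·t012 − e12³ − 1 and ⊥_c = e21³·t012 + t012 − e01²·e10·e12·e21², and set p = (e12³ + 1)/(e01·e10²·e12²·e21) and q = (e01²·e10·e12·e21²)/(e21³ + 1). Then: (a) for positive e01, e10, e12, e21 one has p = q if and only if e01³·e10³·e12³·e21³ = (e12³ + 1)·(e21³ + 1); and (b) the set { (t012, e01, e10, e12, e21) ∈ (0,∞)⁵ : ⊤_c = 0 and ⊥_c = 0 }, with its subspace topology, is homeomorphic to ℝ³. -/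

import Mathlib

/-- `⊤_c`, as a function of `(t012, e01, e10, e12, e21)`. -/
def topC (t012 e01 e10 e12 e21 : ℝ) : ℝ :=
  e01 * e10 ^ 2 * e12 ^ 2 * e21 * t012 - e12 ^ 3 - 1

/-- `⊥_c`, as a function of `(t012, e01, e10, e12, e21)`. -/
def botC (t012 e01 e10 e12 e21 : ℝ) : ℝ :=
  e21 ^ 3 * t012 + t012 - e01 ^ 2 * e10 * e12 * e21 ^ 2

/-- `p = (e12³+1)/(e01·e10²·e12²·e21)`. -/
noncomputable def pC (e01 e10 e12 e21 : ℝ) : ℝ :=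
  (e12 ^ 3 + 1) / (e01 * e10 ^ 2 * e12 ^ 2 * e21)

/-- `q = (e01²·e10·e12·e21²)/(e21³+1)`. -/
noncomputable def qC (e01 e10 e12 e21 : ℝ) : ℝ :=
  (e01 ^ 2 * e10 * e12 * e21 ^ 2) / (e21 ^ 3 + 1)

/-- The middle piece: `⊤_c = 0` and `⊥_c = 0` inside `(0,∞)⁵`, coordinates
`(t012, e01, e10, e12, e21)`. -/
def cyanZeroPiece : Set (Fin 5 → ℝ) :=
  {x | (∀ i, 0 < x i) ∧
    topC (x 0) (x 1) (x 2) (x 3) (x 4) = 0 ∧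
    botC (x 0) (x 1) (x 2) (x 3) (x 4) = 0}

theorem topC_eq_zero_iff {t a b c d : ℝ} (ha : 0 < a) (hb : 0 < b) (hc : 0 < c) (hd : 0 < d) :
    topC t a b c d = 0 ↔ t = pC a b c d := by
  unfold topC pC
  rw [eq_div_iff (by positivity)]
  constructor <;> intro h <;> linarith

theorem botC_eq_zero_iff {t a b c d : ℝ} (hd : 0 < d) :
    botC t a b c d = 0 ↔ t = qC a b c d := by
  unfold botC qC
  rw [eq_div_iff (by positivity)]
  constructor <;> intro h <;> linarith

theorem pC_eq_qC_iff {a b c d : ℝ} (ha : 0 < a) (hb : 0 < b) (hc : 0 < c) (hd : 0 < d) :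
    pC a b c d = qC a b c d ↔
      a ^ 3 * b ^ 3 * c ^ 3 * d ^ 3 = (c ^ 3 + 1) * (d ^ 3 + 1) := by
  unfold pC qC
  rw [div_eq_div_iff (by positivity) (by positivity)]
  constructor <;> intro h <;> linarith

/-- The value of `e10` solving `p = q` for given `e01 = a`, `e12 = c`, `e21 = d`. -/
noncomputable def solE10 (a c d : ℝ) : ℝ :=
  ((c ^ 3 + 1) * (d ^ 3 + 1)) ^ (3⁻¹ : ℝ) / (a * c * d)

theorem solE10_pos {a c d : ℝ} (ha : 0 < a) (hc : 0 < c) (hd : 0 < d) : 0 < solE10 a c d := by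
  unfold solE10
  positivity

theorem pC_eq_qC_iff_eq_solE10 {a b c d : ℝ} (ha : 0 < a) (hb : 0 < b) (hc : 0 < c)
    (hd : 0 < d) : pC a b c d = qC a b c d ↔ b = solE10 a c d := by
  have hroot : (((c ^ 3 + 1) * (d ^ 3 + 1)) ^ (3⁻¹ : ℝ)) ^ 3 = (c ^ 3 + 1) * (d ^ 3 + 1) := by
    have h := Real.rpow_inv_natCast_pow
      (show (0 : ℝ) ≤ (c ^ 3 + 1) * (d ^ 3 + 1) by positivity) three_ne_zero
    exact_mod_cast h
  rw [pC_eq_qC_iff ha hb hc hd, solE10, eq_div_iff (by positivity),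
    ← pow_left_inj₀ (a := b * (a * c * d)) (by positivity) (by positivity) three_ne_zero,
    hroot]
  constructor <;> intro h <;> linarith

theorem mem_cyanZeroPiece_iff {x : Fin 5 → ℝ} (hx : ∀ i, 0 < x i) :
    x ∈ cyanZeroPiece ↔
      x 2 = solE10 (x 1) (x 3) (x 4) ∧ x 0 = qC (x 1) (x 2) (x 3) (x 4) := by
  rw [cyanZeroPiece, Set.mem_ofPred_eq, topC_eq_zero_iff (hx 1) (hx 2) (hx 3) (hx 4),
    botC_eq_zero_iff (hx 4), ← pC_eq_qC_iff_eq_solE10 (hx 1) (hx 2) (hx 3) (hx 4)]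
  constructor
  · rintro ⟨-, h1, h2⟩
    exact ⟨h1.symm.trans h2, h2⟩
  · rintro ⟨h1, h2⟩
    exact ⟨hx, h2.trans h1.symm, h2⟩

/-- The point of the locus `t012 = p = q` with given `e01 = a`, `e12 = c`, `e21 = d`. -/
noncomputable def cyanPoint (a c d : ℝ) : Fin 5 → ℝ :=
  ![qC a (solE10 a c d) c d, a, solE10 a c d, c, d]

theorem cyanPoint_mem {a c d : ℝ} (ha : 0 < a) (hc : 0 < c) (hd : 0 < d) :
    cyanPoint a c d ∈ cyanZeroPiece := by
  have hb := solE10_pos ha hc hd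
  have hq : 0 < qC a (solE10 a c d) c d := by
    unfold qC
    positivity
  refine (mem_cyanZeroPiece_iff fun i => ?_).2 ⟨rfl, rfl⟩
  fin_cases i
  exacts [hq, ha, hb, hc, hd]

theorem cyanPoint_eq {x : Fin 5 → ℝ} (hx : x ∈ cyanZeroPiece) :
    cyanPoint (x 1) (x 3) (x 4) = x := by
  obtain ⟨h2, h0⟩ := (mem_cyanZeroPiece_iff hx.1).1 hx
  funext i
  fin_cases i
  · exact (congrArg (fun b => qC (x 1) b (x 3) (x 4)) h2.symm).trans h0.symm
  · rfl
  · exact h2.symm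
  · rfl
  · rfl

theorem continuous_cyanPoint_exp :
    Continuous fun y : Fin 3 → ℝ =>
      cyanPoint (Real.exp (y 0)) (Real.exp (y 1)) (Real.exp (y 2)) := by
  have hb : Continuous fun y : Fin 3 → ℝ =>
      solE10 (Real.exp (y 0)) (Real.exp (y 1)) (Real.exp (y 2)) := by
    unfold solE10
    refine Continuous.div (Continuous.rpow_const (by fun_prop) fun y => Or.inr (by norm_num))
      (by fun_prop) fun y => by positivity
  have hq : Continuous fun y : Fin 3 → ℝ =>
      qC (Real.exp (y 0)) (solE10 (Real.exp (y 0)) (Real.exp (y 1)) (Real.exp (y 2)))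
        (Real.exp (y 1)) (Real.exp (y 2)) := by
    unfold qC
    exact Continuous.div (by fun_prop) (by fun_prop) fun y => by positivity
  refine continuous_pi fun i => ?_
  fin_cases i
  · exact hq
  · exact Real.continuous_exp.comp (continuous_apply 0)
  · exact hb
  · exact Real.continuous_exp.comp (continuous_apply 1)
  · exact Real.continuous_exp.comp (continuous_apply 2)

/-- Logarithmic coordinates `(log e01, log e12, log e21)` on the locus `t012 = p = q`. -/
noncomputable def cyanZeroPieceHomeomorph : ↥cyanZeroPiece ≃ₜ (Fin 3 → ℝ) where
  toFun x := ![Real.log (x.1 1), Real.log (x.1 3), Real.log (x.1 4)]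
  invFun y := ⟨cyanPoint (Real.exp (y 0)) (Real.exp (y 1)) (Real.exp (y 2)),
    cyanPoint_mem (Real.exp_pos _) (Real.exp_pos _) (Real.exp_pos _)⟩
  left_inv x := by
    apply Subtype.ext
    simpa [Real.exp_log (x.2.1 _)] using cyanPoint_eq x.2
  right_inv y := by
    funext i
    fin_cases i <;> simp [cyanPoint]
  continuous_toFun := by
    have hlog (i : Fin 5) : Continuous fun x : ↥cyanZeroPiece => Real.log (x.1 i) :=
      ((continuous_apply i).comp continuous_subtype_val).log fun x => (x.2.1 i).ne'
    refine continuous_pi fun i => ?_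
    fin_cases i
    exacts [hlog 1, hlog 3, hlog 4]
  continuous_invFun := continuous_cyanPoint_exp.subtype_mk _

theorem stmt_8 :
    (∀ e01 e10 e12 e21 : ℝ, 0 < e01 → 0 < e10 → 0 < e12 → 0 < e21 →
      (pC e01 e10 e12 e21 = qC e01 e10 e12 e21 ↔
        e01 ^ 3 * e10 ^ 3 * e12 ^ 3 * e21 ^ 3 = (e12 ^ 3 + 1) * (e21 ^ 3 + 1))) ∧
    Nonempty (↥cyanZeroPiece ≃ₜ (Fin 3 → ℝ)) :=
  ⟨fun _ _ _ _ h01 h10 h12 h21 => pC_eq_qC_iff h01 h10 h12 h21, ⟨cyanZeroPieceHomeomorph⟩⟩
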